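/- Let S and A be finite types, k_b a natural number, γ ∈ [0,1), and r : S × A → ℝ with |r(s,a)| ≤ r_max for all (s,a). For each t ∈ {0, …, k_b}, let μ_t, μ_t^e be probability distributions on S, let π_t(·|s), π_t^e(·|s) be probability distributions on A for each s ∈ S, and define joints p_t(s,a) = μ_t(s)·π_t(a|s) and p_t^e(s,a) = μ_t^e(s)·π_t^e(a|s). Let P(·|s',a) and P^e(·|s',a) be probability distributions on S for each (s',a) ∈ S × A, and suppose the backward Markov recursions μ_t(s) = ∑_{(s',a)} P(s|s',a)·p_{t+1}(s',a) and μ_t^e(s) = ∑_{(s',a)} P^e(s|s',a)·p_{t+1}^e(s',a) hold for all t < k_b, with μ_{k_b} = μ_{k_b}^e. Assume ε_π ≥ 0 satisfies ∑_{s} μ_t(s)·D_TV(π_t(·|s), π_t^e(·|s)) ≤ ε_π for all t ≤ k_b, and ε_m ≥ 0 satisfies ∑_{(s',a)} p_{t+1}^e(s',a)·D_TV(P(·|s',a), P^e(·|s',a)) ≤ ε_m for all t < k_b. Then the returns η[π] = ∑_{t=0}^{k_b} γ^t ∑_{(s,a)} r(s,a)·p_t(s,a) and η[π^e] = ∑_{t=0}^{k_b}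 γ^t ∑_{(s,a)} r(s,a)·p_t^e(s,a) satisfy |η[π] − η[π^e]| ≤ (2·r_max·(1 − γ^{k_b+1})/(1 − γ))·(ε_π + k_b·(ε_π + ε_m)). -/

import Mathlib

open Finset

/-- Total variation distance between two (probability) distributions on a finite type. -/
noncomputable def tvDist {X : Type*} [Fintype X] (p q : X → ℝ) : ℝ :=
  (1 / 2) * ∑ x, |p x - q x|

theorem tvDist_comm {X : Type*} [Fintype X] (p q : X → ℝ) : tvDist p q = tvDist q p := by
  simp only [tvDist, abs_sub_comm]

/-- The total variation distance between joint distributions is at most that between the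
marginals plus the expected distance between the conditional distributions. -/
theorem tvDist_joint_le {X Y : Type*} [Fintype X] [Fintype Y] (f g : X → ℝ) (K L : X → Y → ℝ)
    (hf : ∀ x, 0 ≤ f x) (hL : ∀ x y, 0 ≤ L x y) (hL1 : ∀ x, ∑ y, L x y = 1) :
    tvDist (fun z : X × Y => f z.1 * K z.1 z.2) (fun z => g z.1 * L z.1 z.2)
      ≤ tvDist f g + ∑ x, f x * tvDist (K x) (L x) := by
  have h (x : X) : ∑ y, |f x * K x y - g x * L x y|
      ≤ |f x - g x| + f x * ∑ y, |K x y - L x y| := by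
    calc ∑ y, |f x * K x y - g x * L x y|
        ≤ ∑ y, (|f x - g x| * L x y + f x * |K x y - L x y|) := by
          refine Finset.sum_le_sum fun y _ => ?_
          have := abs_add_le ((f x - g x) * L x y) (f x * (K x y - L x y))
          rw [abs_mul, abs_mul, abs_of_nonneg (hL x y), abs_of_nonneg (hf x)] at this
          refine (congrArg abs ?_).trans_le this
          ring
      _ = |f x - g x| + f x * ∑ y, |K x y - L x y| := by
          rw [Finset.sum_add_distrib, ← Finset.mul_sum, ← Finset.mul_sum, hL1, mul_one]
  calc tvDist (fun z : X × Y => f z.1 * K z.1 z.2) (fun z => g z.1 * L z.1 z.2)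
      = (1 / 2) * ∑ x, ∑ y, |f x * K x y - g x * L x y| := by
        rw [tvDist, Fintype.sum_prod_type]
    _ ≤ (1 / 2) * ∑ x, (|f x - g x| + f x * ∑ y, |K x y - L x y|) := by
        gcongr with x
        exact h x
    _ = tvDist f g + ∑ x, f x * tvDist (K x) (L x) := by
        simp only [tvDist, Finset.sum_add_distrib, mul_add, Finset.mul_sum]
        congr 1
        refine Finset.sum_congr rfl fun x _ => Finset.sum_congr rfl fun y _ => ?_
        ring

/-- Passing to the second marginal does not increase the total variation distance. -/
theorem tvDist_marginal_le {X Y : Type*} [Fintype X] [Fintype Y] (p q : X × Y → ℝ) :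
    tvDist (fun y => ∑ x, p (x, y)) (fun y => ∑ x, q (x, y)) ≤ tvDist p q := by
  simp only [tvDist]
  rw [Fintype.sum_prod_type_right]
  gcongr with y
  rw [← Finset.sum_sub_distrib]
  exact Finset.abs_sum_le_sum_abs _ _

/-- Expectations of a bounded function differ by at most twice the bound times the total
variation distance. -/
theorem abs_sum_sub_sum_le_tvDist {X : Type*} [Fintype X] (r p q : X → ℝ) (C : ℝ)
    (hr : ∀ x, |r x| ≤ C) :
    |∑ x, r x * p x - ∑ x, r x * q x| ≤ 2 * C * tvDist p q := by
  calc |∑ x, r x * p x - ∑ x, r x * q x| = |∑ x, r x * (p x - q x)| := by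
        simp only [mul_sub, Finset.sum_sub_distrib]
    _ ≤ ∑ x, |r x * (p x - q x)| := Finset.abs_sum_le_sum_abs _ _
    _ ≤ ∑ x, C * |p x - q x| := by
        refine Finset.sum_le_sum fun x _ => ?_
        rw [abs_mul]
        exact mul_le_mul_of_nonneg_right (hr x) (abs_nonneg _)
    _ = 2 * C * tvDist p q := by
        rw [← Finset.mul_sum, tvDist]
        ring

/-- Theorem 1 of the paper: the discrepancy between the `k_b`-step
discounted returns of the current policy under the real backward dynamics and of the
presumed expert policy under the presumed backward model is bounded by
`2 * r_max * (1 - γ^(k_b+1)) / (1 - γ) * (ε_π + k_b * (ε_π + ε_m))`. -/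
theorem return_discrepancy_bound {S A : Type*} [Fintype S] [Fintype A]
    (kb : ℕ) (γ : ℝ) (hγ0 : 0 ≤ γ) (hγ1 : γ < 1)
    (r : S × A → ℝ) (rmax : ℝ) (hr : ∀ x, |r x| ≤ rmax)
    (μ μe : ℕ → S → ℝ) (π πe : ℕ → S → A → ℝ)
    (P Pe : S × A → S → ℝ) (επ εm : ℝ)
    (hμ0 : ∀ t ≤ kb, ∀ s, 0 ≤ μ t s) (hμ1 : ∀ t ≤ kb, ∑ s, μ t s = 1)
    (hμe0 : ∀ t ≤ kb, ∀ s, 0 ≤ μe t s) (hμe1 : ∀ t ≤ kb, ∑ s, μe t s = 1)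
    (hπ0 : ∀ t ≤ kb, ∀ s a, 0 ≤ π t s a) (hπ1 : ∀ t ≤ kb, ∀ s, ∑ a, π t s a = 1)
    (hπe0 : ∀ t ≤ kb, ∀ s a, 0 ≤ πe t s a) (hπe1 : ∀ t ≤ kb, ∀ s, ∑ a, πe t s a = 1)
    (hP0 : ∀ x s, 0 ≤ P x s) (hP1 : ∀ x, ∑ s, P x s = 1)
    (hPe0 : ∀ x s, 0 ≤ Pe x s) (hPe1 : ∀ x, ∑ s, Pe x s = 1)
    (hrec : ∀ t < kb, ∀ s,
      μ t s = ∑ x : S × A, P x s * (μ (t + 1) x.1 * π (t + 1) x.1 x.2))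
    (hrece : ∀ t < kb, ∀ s,
      μe t s = ∑ x : S × A, Pe x s * (μe (t + 1) x.1 * πe (t + 1) x.1 x.2))
    (hterm : μ kb = μe kb)
    (hεπ : 0 ≤ επ)
    (hπbound : ∀ t ≤ kb, ∑ s, μ t s * tvDist (π t s) (πe t s) ≤ επ)
    (hεm : 0 ≤ εm)
    (hmbound : ∀ t < kb,
      ∑ x : S × A, (μe (t + 1) x.1 * πe (t + 1) x.1 x.2) * tvDist (P x) (Pe x) ≤ εm) :
    |(∑ t ∈ Finset.range (kb + 1), γ ^ t * ∑ x : S × A, r x * (μ t x.1 * π t x.1 x.2))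
        - ∑ t ∈ Finset.range (kb + 1), γ ^ t * ∑ x : S × A, r x * (μe t x.1 * πe t x.1 x.2)|
      ≤ 2 * rmax * (1 - γ ^ (kb + 1)) / (1 - γ) * (επ + (kb : ℝ) * (επ + εm)) := by
  have hjoint (t : ℕ) (ht : t ≤ kb) :
      tvDist (fun x : S × A => μ t x.1 * π t x.1 x.2) (fun x => μe t x.1 * πe t x.1 x.2)
        ≤ tvDist (μ t) (μe t) + επ :=
    (tvDist_joint_le (μ t) (μe t) (π t) (πe t) (hμ0 t ht) (hπe0 t ht) (hπe1 t ht)).trans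
      (by gcongr; exact hπbound t ht)
  have hstep (t : ℕ) (ht : t < kb) : tvDist (μ t) (μe t)
      ≤ tvDist (fun x : S × A => μ (t + 1) x.1 * π (t + 1) x.1 x.2)
          (fun x => μe (t + 1) x.1 * πe (t + 1) x.1 x.2) + εm := by
    have hpe (x : S × A) : 0 ≤ μe (t + 1) x.1 * πe (t + 1) x.1 x.2 :=
      mul_nonneg (hμe0 _ ht _) (hπe0 _ ht _ _)
    have h := (tvDist_marginal_le _ _).trans
      (tvDist_joint_le (fun x : S × A => μe (t + 1) x.1 * πe (t + 1) x.1 x.2)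
        (fun x => μ (t + 1) x.1 * π (t + 1) x.1 x.2) Pe P hpe hP0 hP1)
    have hm := hmbound t ht
    simp only [tvDist_comm (P _)] at hm
    rw [tvDist_comm (μ t), tvDist_comm (fun x : S × A => μ (t + 1) x.1 * π (t + 1) x.1 x.2),
      funext (hrec t ht), funext (hrece t ht)]
    simp only [mul_comm (P _ _), mul_comm (Pe _ _)]
    linarith
  have hmarg (n : ℕ) : ∀ t, t + n = kb → tvDist (μ t) (μe t) ≤ n * (επ + εm) := by
    induction n with
    | zero =>
      rintro t rfl
      simp only [add_zero] at hterm
      simp [hterm, tvDist]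
    | succ n ih =>
      intro t ht
      have h₁ := hstep t (by omega)
      have h₂ := hjoint (t + 1) (by omega)
      have h₃ := ih (t + 1) (by omega)
      push_cast
      linarith
  have hdist (t : ℕ) (ht : t ≤ kb) :
      tvDist (fun x : S × A => μ t x.1 * π t x.1 x.2) (fun x => μe t x.1 * πe t x.1 x.2)
        ≤ επ + kb * (επ + εm) := by
    have h₁ := hjoint t ht
    have h₂ := hmarg (kb - t) t (by omega)
    have h₃ : ((kb - t : ℕ) : ℝ) * (επ + εm) ≤ kb * (επ + εm) := by
      gcongr
      omega
    linarith
  have hrmax : 0 ≤ rmax := by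
    obtain ⟨s, -, -⟩ := Finset.exists_ne_zero_of_sum_ne_zero
      ((hμ1 kb le_rfl).trans_ne one_ne_zero)
    obtain ⟨a, -, -⟩ := Finset.exists_ne_zero_of_sum_ne_zero
      ((hπ1 kb le_rfl s).trans_ne one_ne_zero)
    exact (abs_nonneg _).trans (hr (s, a))
  rw [← Finset.sum_sub_distrib]
  calc |∑ t ∈ Finset.range (kb + 1), (γ ^ t * ∑ x : S × A, r x * (μ t x.1 * π t x.1 x.2)
          - γ ^ t * ∑ x : S × A, r x * (μe t x.1 * πe t x.1 x.2))|
      ≤ ∑ t ∈ Finset.range (kb + 1), γ ^ t * (2 * rmax * (επ + kb * (επ + εm))) := by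
        refine (Finset.abs_sum_le_sum_abs _ _).trans (Finset.sum_le_sum fun t ht => ?_)
        rw [← mul_sub, abs_mul, abs_of_nonneg (pow_nonneg hγ0 t)]
        gcongr
        refine (abs_sum_sub_sum_le_tvDist r _ _ rmax hr).trans ?_
        gcongr
        exact hdist t (Nat.lt_succ_iff.mp (Finset.mem_range.mp ht))
    _ = 2 * rmax * (1 - γ ^ (kb + 1)) / (1 - γ) * (επ + (kb : ℝ) * (επ + εm)) := by
        rw [← Finset.sum_mul, geom_sum_eq hγ1.ne, ← neg_div_neg_eq, neg_sub, neg_sub]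
        ring
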